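/- Let P ⊆ ℕ. If the spacing shift (Σ_P, σ_P) is topologically transitive (some point has dense forward orbit), then P is an IP−IP set: there exists an IP-set S ⊆ ℕ such that every positive difference s − t with s, t ∈ S, s > t, belongs to P. -/

import Mathlib

open Filter Topology

/-- The spacing shift `Σ_P ⊆ {0,1}^ℕ` determined by `P ⊆ ℕ`: a `0`-`1` sequence `x`
(encoded as `x : ℕ → Bool`) belongs to `Σ_P` iff whenever two coordinates are `1`,
the (positive) distance between them lies in `P`. -/
def SpacingShift (P : Set ℕ) : Set (ℕ → Bool) :=
  {x | ∀ i j : ℕ, i < j → x i = true → x j = true → j - i ∈ P}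

/-- The left shift map `σ` on sequences. -/
def shift (x : ℕ → Bool) : ℕ → Bool := fun n => x (n + 1)

/-- The support `A_y = {i : y_i = 1}` of a point of the shift space. -/
def supp (x : ℕ → Bool) : Set ℕ := {i | x i = true}

/-- `A ⊆ ℕ` has density `d`, i.e. `|A ∩ {1,…,n}| / n → d`. -/
def HasDensity (A : Set ℕ) (d : ℝ) : Prop :=
  Tendsto (fun n : ℕ => (Nat.card (A ∩ Set.Icc 1 n : Set ℕ) : ℝ) / n) atTop (𝓝 d)

/-- The upper density `d̄(A) = limsup_n |A ∩ {1,…,n}| / n`. -/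
noncomputable def upperDensity (A : Set ℕ) : ℝ :=
  limsup (fun n : ℕ => (Nat.card (A ∩ Set.Icc 1 n : Set ℕ) : ℝ) / n) atTop

/-- The upper Banach density `d*(A)`: the limsup, as the window length tends to infinity,
of the maximal proportion of elements of `A` in a window of that length. -/
noncomputable def upperBanachDensity (A : Set ℕ) : ℝ :=
  limsup (fun n : ℕ =>
    ⨆ m : ℕ, (Nat.card (A ∩ Set.Icc m (m + n) : Set ℕ) : ℝ) / (n + 1)) atTop

/-- `D ⊆ ℕ` is a Δ-set: it contains the difference set `{s_i - s_j : i > j}` of some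
strictly increasing sequence of natural numbers. -/
def IsDeltaSet (D : Set ℕ) : Prop :=
  ∃ s : ℕ → ℕ, StrictMono s ∧ ∀ i j : ℕ, j < i → s i - s j ∈ D

/-- `D ⊆ ℕ` is a Δ*-set: it meets every Δ-set. -/
def IsDeltaStarSet (D : Set ℕ) : Prop :=
  ∀ D' : Set ℕ, IsDeltaSet D' → (D ∩ D').Nonempty

open Classical in
/-- The standard metric on the shift space: `d(x,y) = 2^{-min{n : x_n ≠ y_n}}`,
and `d(x,x) = 0`. -/
noncomputable def seqDist (x y : ℕ → Bool) : ℝ :=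
  if x = y then 0 else (2 : ℝ)⁻¹ ^ sInf {n : ℕ | x n ≠ y n}

/-- The set `FS((a_n))` of finite sums of a sequence of natural numbers:
all sums `a_{i_1} + ⋯ + a_{i_k}` with `i_1 < ⋯ < i_k`. -/
def FSseq (a : ℕ → ℕ) : Set ℕ :=
  {n | ∃ F : Finset ℕ, F.Nonempty ∧ n = ∑ i ∈ F, a i}

/-- `S ⊆ ℕ` is an IP-set: it contains the finite sums of some sequence of positive
natural numbers. -/
def IsIPSet (S : Set ℕ) : Prop :=
  ∃ a : ℕ → ℕ, (∀ n, 0 < a n) ∧ FSseq a ⊆ S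

/-- The set `FS(A)` of finite sums of distinct elements of a set `A ⊆ ℕ`. -/
def FSset (A : Set ℕ) : Set ℕ :=
  {n | ∃ F : Finset ℕ, ↑F ⊆ A ∧ F.Nonempty ∧ n = ∑ i ∈ F, i}

/-- The spacing shift `(Σ_P, σ_P)` is topologically transitive: some point of `Σ_P`
has forward orbit (under the shift) dense in `Σ_P`. -/
def IsTransitiveShift (P : Set ℕ) : Prop :=
  ∃ x ∈ SpacingShift P, SpacingShift P ⊆ closure {y : ℕ → Bool | ∃ n : ℕ, shift^[n] x = y}

/-- `E ⊆ ℕ` is density intersective: it meets the difference set `A - A` of every set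
`A ⊆ ℕ` of positive upper Banach density. -/
def DensityIntersective (E : Set ℕ) : Prop :=
  ∀ A : Set ℕ, 0 < upperBanachDensity A → ∃ a ∈ A, ∃ a' ∈ A, a' < a ∧ a - a' ∈ E

/-- All positive differences of elements of `F` lie in `P`. -/
def PosDiffsIn (P : Set ℕ) (F : Finset ℕ) : Prop :=
  ∀ s ∈ F, ∀ t ∈ F, t < s → s - t ∈ P

theorem shift_iterate_apply (x : ℕ → Bool) (n k : ℕ) : shift^[n] x k = x (n + k) := by
  induction n generalizing x with
  | zero => simp
  | succ n ih =>
    rw [Function.iterate_succ_apply, ih, shift]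
    congr 1
    omega

/-- A point with dense orbit shows every admissible finite pattern arbitrarily far out. -/
theorem exists_translate_subset_supp {P : Set ℕ} {x : ℕ → Bool}
    (hx : SpacingShift P ⊆ closure {y : ℕ → Bool | ∃ n : ℕ, shift^[n] x = y})
    {F : Finset ℕ} (hF : PosDiffsIn P F) (N : ℕ) :
    ∃ m, N ≤ m ∧ ∀ s ∈ F, m + s ∈ supp x := by
  classical
  let y : ℕ → Bool := fun i => decide (∃ s ∈ F, N + s = i)
  have hy : y ∈ SpacingShift P := by
    intro i j hij hi hj
    obtain ⟨s, hs, rfl⟩ := of_decide_eq_true hi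
    obtain ⟨t, ht, rfl⟩ := of_decide_eq_true hj
    rw [Nat.add_sub_add_left]
    exact hF t ht s hs (by omega)
  have hU : IsOpen (⋂ s ∈ F, {z : ℕ → Bool | z (N + s) = true}) :=
    isOpen_biInter_finset fun s _ =>
      (isOpen_discrete ({true} : Set Bool)).preimage
        (continuous_apply (A := fun _ : ℕ => Bool) (N + s))
  obtain ⟨z, hz, n, rfl⟩ := mem_closure_iff.1 (hx hy) _ hU
    (Set.mem_iInter₂.2 fun s hs => decide_eq_true ⟨s, hs, rfl⟩)
  refine ⟨n + N, by omega, fun s hs => ?_⟩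
  have h := Set.mem_iInter₂.1 hz s hs
  rw [Set.mem_ofPred_eq, shift_iterate_apply, ← add_assoc] at h
  exact h

theorem PosDiffsIn.exists_union_translate {P : Set ℕ} (h : IsTransitiveShift P)
    {F : Finset ℕ} (hF : PosDiffsIn P F) :
    ∃ a, 0 < a ∧ PosDiffsIn P (F ∪ F.image (· + a)) := by
  obtain ⟨x, hxP, hx⟩ := h
  obtain ⟨m, -, hm⟩ := exists_translate_subset_supp hx hF 0
  obtain ⟨k, hk, hk'⟩ := exists_translate_subset_supp hx hF (m + F.sup id + 1)
  have hsup : ∀ s ∈ F, s ≤ F.sup id := fun s hs => Finset.le_sup (f := id) hs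
  refine ⟨k - m, by omega, fun s hs t ht hts => ?_⟩
  simp only [Finset.mem_union, Finset.mem_image] at hs ht
  rcases hs with hs | ⟨s, hs, rfl⟩ <;> rcases ht with ht | ⟨t, ht, rfl⟩
  · exact hF s hs t ht hts
  · have := hsup s hs
    omega
  · have := hsup t ht
    have hP := hxP (m + t) (k + s) (by omega) (hm t ht) (hk' s hs)
    rwa [show k + s - (m + t) = s + (k - m) - t by omega] at hP
  · rw [Nat.add_sub_add_right]
    exact hF s hs t ht (by omega)

/-- If `(Σ_P, σ_P)` is topologically transitive, then `P` is an IP−IP set: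
there is an IP-set `S` all of whose positive differences lie in `P`. -/
theorem transitive_implies_IP_sub_IP (P : Set ℕ)
    (h : IsTransitiveShift P) :
    ∃ S : Set ℕ, IsIPSet S ∧ ∀ s ∈ S, ∀ t ∈ S, t < s → s - t ∈ P := by
  choose! f hpos hf using fun F (hF : PosDiffsIn P F) => hF.exists_union_translate h
  let G : ℕ → Finset ℕ := fun n => (fun F => F ∪ F.image (· + f F))^[n] {0}
  have G_succ (n : ℕ) : G (n + 1) = G n ∪ (G n).image (· + f (G n)) :=
    Function.iterate_succ_apply' _ _ _
  have hG (n : ℕ) : PosDiffsIn P (G n) := by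
    induction n with
    | zero => simp [G, PosDiffsIn]
    | succ n ih => rw [G_succ]; exact hf _ ih
  have hsum (n : ℕ) : ∀ F ⊆ Finset.range n, ∑ i ∈ F, f (G i) ∈ G n := by
    induction n with
    | zero => intro F hF; simp_all [G]
    | succ n ih =>
      intro F hF
      rw [Finset.range_add_one, Finset.subset_insert_iff] at hF
      rw [G_succ, Finset.mem_union, Finset.mem_image]
      by_cases hn : n ∈ F
      · exact Or.inr ⟨_, ih _ hF, Finset.sum_erase_add F _ hn⟩
      · rw [Finset.erase_eq_of_notMem hn] at hF
        exact Or.inl (ih F hF)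
  refine ⟨FSseq fun n => f (G n), ⟨_, fun n => hpos _ (hG n), subset_rfl⟩, ?_⟩
  rintro _ ⟨A, -, rfl⟩ _ ⟨B, -, rfl⟩ hlt
  obtain ⟨n, hn⟩ := (A ∪ B).exists_nat_subset_range
  exact hG n _ (hsum n A (Finset.subset_union_left.trans hn))
    _ (hsum n B (Finset.subset_union_right.trans hn)) hlt
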